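/- Reduction to Heun form: let λ ∈ ℂ with λ ≠ 1, and suppose there exists a function f : ℝ → ℂ, C^∞ on [0,1] and not identically zero on [0,1], satisfying for all ρ ∈ (0,1) the spectral equation −(1−ρ²)f''(ρ) − (2/ρ)f'(ρ) + 2(λ+1)ρ f'(ρ) + (2(1−6ρ²+ρ⁴)/(ρ²(1+ρ²)²)) f(ρ) + λ(λ+1) f(ρ) = 0. Then there exists a function g : ℝ → ℂ, C^∞ on [0,1] and not identically zero on [0,1], satisfying for all z ∈ (0,1) the Heun equation g''(z) + (7/(2z) + λ/(z−1) + 1/(2(z−2))) g'(z) + (1/4)((λ+4)(λ+2)z − (λ²+12λ+12))/(z(z−1)(z−2)) g(z) = 0. -/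

import Mathlib

open Set

/-- The spectral equation for the linearized wave maps operator. -/
def SpectralEq (l : ℂ) (f : ℝ → ℂ) (ρ : ℝ) : Prop :=
  -(1 - (ρ : ℂ)^2) * deriv (deriv f) ρ - (2 / (ρ : ℂ)) * deriv f ρ
    + 2 * (l + 1) * (ρ : ℂ) * deriv f ρ
    + (2 * (1 - 6 * (ρ : ℂ)^2 + (ρ : ℂ)^4) / ((ρ : ℂ)^2 * (1 + (ρ : ℂ)^2)^2)) * f ρ
    + l * (l + 1) * f ρ = 0

/-- The Heun equation in standard form arising from the supersymmetric problem. -/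
def HeunEq (l : ℂ) (g : ℝ → ℂ) (z : ℝ) : Prop :=
  deriv (deriv g) z
    + (7 / (2 * (z : ℂ)) + l / ((z : ℂ) - 1) + 1 / (2 * ((z : ℂ) - 2))) * deriv g z
    + (1 / 4) * (((l + 4) * (l + 2) * (z : ℂ) - (l ^ 2 + 12 * l + 12)) /
        ((z : ℂ) * ((z : ℂ) - 1) * ((z : ℂ) - 2))) * g z = 0

open Filter Topology MeasureTheory

theorem hasDerivWithinAt_Icc_of_hasDerivAt_Ioo {u v : ℝ → ℂ} {a b : ℝ} (hab : a < b)
    (hu : ContinuousOn u (Icc a b)) (hv : ContinuousOn v (Icc a b))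
    (h : ∀ x ∈ Ioo a b, HasDerivAt u (v x) x) :
    ∀ x ∈ Icc a b, HasDerivWithinAt u (v x) (Icc a b) x := by
  have hd : DifferentiableOn ℝ u (Ioo a b) := fun x hx =>
    (h x hx).differentiableAt.differentiableWithinAt
  intro x hx
  rcases eq_or_lt_of_le hx.1 with rfl | hax
  · refine (hasDerivWithinAt_Ici_of_tendsto_deriv hd
      ((hu _ hx).mono Ioo_subset_Icc_self) (Ioo_mem_nhdsGT hab) ?_).mono Icc_subset_Ici_self
    refine Tendsto.congr' (f₁ := v) ?_ ?_
    · filter_upwards [Ioo_mem_nhdsGT hab] with y hy using (h y hy).deriv.symm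
    · exact ((hv _ hx).mono Ioo_subset_Icc_self).tendsto.mono_left
        (nhdsWithin_le_of_mem (Ioo_mem_nhdsGT hab))
  rcases eq_or_lt_of_le hx.2 with rfl | hxb
  · refine (hasDerivWithinAt_Iic_of_tendsto_deriv hd
      ((hu _ hx).mono Ioo_subset_Icc_self) (Ioo_mem_nhdsLT hab) ?_).mono Icc_subset_Iic_self
    refine Tendsto.congr' (f₁ := v) ?_ ?_
    · filter_upwards [Ioo_mem_nhdsLT hab] with y hy using (h y hy).deriv.symm
    · exact ((hv _ hx).mono Ioo_subset_Icc_self).tendsto.mono_left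
        (nhdsWithin_le_of_mem (Ioo_mem_nhdsLT hab))
  · exact (h x ⟨hax, hxb⟩).hasDerivWithinAt

theorem contDiffOn_succ_Icc_of_hasDerivAt_Ioo {u v : ℝ → ℂ} {a b : ℝ} (hab : a < b) {n : ℕ}
    (hu : ContinuousOn u (Icc a b)) (hv : ContDiffOn ℝ n v (Icc a b))
    (h : ∀ x ∈ Ioo a b, HasDerivAt u (v x) x) :
    ContDiffOn ℝ (n + 1 : ℕ) u (Icc a b) := by
  have h' := hasDerivWithinAt_Icc_of_hasDerivAt_Ioo hab hu hv.continuousOn h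
  push_cast
  rw [contDiffOn_succ_iff_derivWithin (uniqueDiffOn_Icc hab)]
  refine ⟨fun x hx => (h' x hx).differentiableWithinAt, fun hn => by simp at hn, ?_⟩
  exact hv.congr fun x hx => (h' x hx).derivWithin (uniqueDiffOn_Icc hab x hx)

theorem hasDerivAt_derivWithin_Icc {F : ℝ → ℂ} {a b x : ℝ}
    (hF : DifferentiableOn ℝ F (Icc a b)) (hx : x ∈ Ioo a b) :
    HasDerivAt F (derivWithin F (Icc a b) x) x :=
  (hF x (Ioo_subset_Icc_self hx)).hasDerivWithinAt.hasDerivAt (Icc_mem_nhds hx.1 hx.2)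

theorem mul_mem_Icc_zero {b t x : ℝ} (ht : t ∈ Icc (0 : ℝ) 1) (hx : x ∈ Icc 0 b) :
    t * x ∈ Icc 0 b :=
  ⟨mul_nonneg ht.1 hx.1, (mul_le_of_le_one_left hx.1 ht.2).trans hx.2⟩

theorem continuousOn_mul_comp_mul {w F : ℝ → ℂ} {b x : ℝ} (hw : ContinuousOn w (Icc 0 1))
    (hF : ContinuousOn F (Icc 0 b)) (hx : x ∈ Icc 0 b) :
    ContinuousOn (fun t => w t * F (t * x)) (Icc 0 1) :=
  hw.mul (hF.comp (by fun_prop) fun _ ht => mul_mem_Icc_zero ht hx)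

theorem aestronglyMeasurable_uIoc_zero_one {G : ℝ → ℂ} (hG : ContinuousOn G (Icc 0 1)) :
    AEStronglyMeasurable G (volume.restrict (uIoc 0 1)) := by
  rw [uIoc_of_le zero_le_one]
  exact (hG.mono Ioc_subset_Icc_self).aestronglyMeasurable measurableSet_Ioc

theorem exists_bound_mul_comp_mul {w F : ℝ → ℂ} {b : ℝ} (hw : ContinuousOn w (Icc 0 1))
    (hF : ContinuousOn F (Icc 0 b)) :
    ∃ C : ℝ, ∀ t ∈ uIoc (0 : ℝ) 1, ∀ x ∈ Icc 0 b, ‖w t * F (t * x)‖ ≤ C := by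
  obtain ⟨C, hC⟩ := isCompact_Icc.exists_bound_of_continuousOn hw
  obtain ⟨D, hD⟩ := isCompact_Icc.exists_bound_of_continuousOn hF
  refine ⟨C * D, fun t ht x hx => ?_⟩
  rw [uIoc_of_le zero_le_one] at ht
  have ht' := Ioc_subset_Icc_self ht
  rw [norm_mul]
  exact mul_le_mul (hC t ht') (hD _ (mul_mem_Icc_zero ht' hx)) (norm_nonneg _)
    ((norm_nonneg _).trans (hC t ht'))

theorem continuousOn_weightedAverage {w F : ℝ → ℂ} {b : ℝ} (hw : ContinuousOn w (Icc 0 1))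
    (hF : ContinuousOn F (Icc 0 b)) :
    ContinuousOn (fun x => ∫ t in (0 : ℝ)..1, w t * F (t * x)) (Icc 0 b) := by
  obtain ⟨C, hC⟩ := exists_bound_mul_comp_mul hw hF
  intro x hx
  refine intervalIntegral.continuousWithinAt_of_dominated_interval (bound := fun _ => C) ?_ ?_
    intervalIntegrable_const ?_
  · filter_upwards [self_mem_nhdsWithin] with y hy using
      aestronglyMeasurable_uIoc_zero_one (continuousOn_mul_comp_mul hw hF hy)
  · filter_upwards [self_mem_nhdsWithin] with y hy
    exact Eventually.of_forall fun t ht => hC t ht y hy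
  · refine Eventually.of_forall fun t ht => ?_
    rw [uIoc_of_le zero_le_one] at ht
    have ht' := Ioc_subset_Icc_self ht
    exact (continuousOn_const.mul (hF.comp (f := fun x => t * x) (by fun_prop)
      fun _ hy => mul_mem_Icc_zero ht' hy)) x hx

theorem hasDerivAt_weightedAverage {w F F' : ℝ → ℂ} {b : ℝ} (hw : ContinuousOn w (Icc 0 1))
    (hF : ContinuousOn F (Icc 0 b)) (hF' : ContinuousOn F' (Icc 0 b))
    (h : ∀ x ∈ Ioo 0 b, HasDerivAt F (F' x) x) {x : ℝ} (hx : x ∈ Ioo 0 b) :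
    HasDerivAt (fun x => ∫ t in (0 : ℝ)..1, w t * F (t * x))
      (∫ t in (0 : ℝ)..1, (w t * t) * F' (t * x)) x := by
  have hw' : ContinuousOn (fun t : ℝ => w t * (t : ℂ)) (Icc 0 1) := hw.mul (by fun_prop)
  obtain ⟨C, hC⟩ := exists_bound_mul_comp_mul hw' hF'
  refine (intervalIntegral.hasDerivAt_integral_of_dominated_loc_of_deriv_le
    (F' := fun x t => (w t * t) * F' (t * x)) (bound := fun _ => C)
    (Ioo_mem_nhds hx.1 hx.2) ?_ ?_ ?_ ?_ intervalIntegrable_const ?_).2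
  · filter_upwards [Ioo_mem_nhds hx.1 hx.2] with y hy using aestronglyMeasurable_uIoc_zero_one
      (continuousOn_mul_comp_mul hw hF (Ioo_subset_Icc_self hy))
  · refine ContinuousOn.intervalIntegrable ?_
    rw [uIcc_of_le zero_le_one]
    exact continuousOn_mul_comp_mul hw hF (Ioo_subset_Icc_self hx)
  · exact aestronglyMeasurable_uIoc_zero_one
      (continuousOn_mul_comp_mul hw' hF' (Ioo_subset_Icc_self hx))
  · exact Eventually.of_forall fun t ht y hy => hC t ht y (Ioo_subset_Icc_self hy)
  · refine Eventually.of_forall fun t ht y hy => ?_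
    rw [uIoc_of_le zero_le_one] at ht
    have hty : t * y ∈ Ioo 0 b :=
      ⟨mul_pos ht.1 hy.1, (mul_le_of_le_one_left hy.1.le ht.2).trans_lt hy.2⟩
    have := ((h _ hty).scomp y ((hasDerivAt_id y).const_mul t)).const_mul (w t)
    refine this.congr_deriv ?_
    simp only [mul_one, Complex.real_smul]
    ring

theorem contDiffOn_weightedAverage {b : ℝ} (hb : 0 < b) (n : ℕ) :
    ∀ {w F : ℝ → ℂ}, ContinuousOn w (Icc 0 1) → ContDiffOn ℝ n F (Icc 0 b) →
      ContDiffOn ℝ n (fun x => ∫ t in (0 : ℝ)..1, w t * F (t * x)) (Icc 0 b) := by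
  induction n with
  | zero =>
    intro w F hw hF
    simpa using continuousOn_weightedAverage hw hF.continuousOn
  | succ n ih =>
    intro w F hw hF
    have hF' : ContDiffOn ℝ n (derivWithin F (Icc 0 b)) (Icc 0 b) :=
      hF.derivWithin (uniqueDiffOn_Icc hb) (by norm_cast)
    refine contDiffOn_succ_Icc_of_hasDerivAt_Ioo hb
      (continuousOn_weightedAverage hw hF.continuousOn)
      (ih (w := fun t => w t * t) (hw.mul (by fun_prop)) hF') fun x hx => ?_
    exact hasDerivAt_weightedAverage hw hF.continuousOn hF'.continuousOn
      (fun y hy => hasDerivAt_derivWithin_Icc (hF.differentiableOn (by simp)) hy) hx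

/-- Hadamard's lemma on an interval: a smooth function is its value at `0` plus `x` times a smooth
function. -/
theorem exists_contDiffOn_eq_add_mul {F : ℝ → ℂ} {b : ℝ} (hb : 0 < b)
    (hF : ContDiffOn ℝ (⊤ : ℕ∞) F (Icc 0 b)) :
    ∃ k : ℝ → ℂ, ContDiffOn ℝ (⊤ : ℕ∞) k (Icc 0 b) ∧ ∀ x ∈ Icc 0 b, F x = F 0 + x * k x := by
  have hF' : ContDiffOn ℝ (⊤ : ℕ∞) (derivWithin F (Icc 0 b)) (Icc 0 b) :=
    hF.derivWithin (uniqueDiffOn_Icc hb) (by norm_cast)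
  refine ⟨fun x => ∫ t in (0 : ℝ)..1, (1 : ℂ) * derivWithin F (Icc 0 b) (t * x), ?_, ?_⟩
  · rw [contDiffOn_infty]
    exact fun n => contDiffOn_weightedAverage hb n (w := fun _ => 1) continuousOn_const
      (hF'.of_le (by exact_mod_cast le_top))
  · intro x hx
    have hsub : Icc 0 x ⊆ Icc 0 b := Icc_subset_Icc le_rfl hx.2
    have := intervalIntegral.integral_eq_sub_of_hasDerivAt_of_le hx.1
      (hF.continuousOn.mono hsub) (f' := derivWithin F (Icc 0 b))
      (fun y hy => hasDerivAt_derivWithin_Icc (hF.differentiableOn (by simp))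
        ⟨hy.1, hy.2.trans_le hx.2⟩)
      (ContinuousOn.intervalIntegrable (by
        rw [uIcc_of_le hx.1]; exact hF'.continuousOn.mono hsub))
    have h2 := intervalIntegral.smul_integral_comp_mul_right (derivWithin F (Icc 0 b)) x
      (a := 0) (b := 1)
    simp only [one_mul, zero_mul, Complex.real_smul] at h2 ⊢
    rw [h2, this]
    ring

theorem contDiffOn_of_regularSingular {g g₁ P q B α : ℝ → ℂ} {b c : ℝ} (hb : 0 < b) (hc : 1 < c)
    (hg : ContinuousOn g (Icc 0 b)) (hP : ContDiffOn ℝ (⊤ : ℕ∞) P (Icc 0 b))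
    (hP0 : ∀ x ∈ Icc 0 b, P x ≠ 0) (hB : ContDiffOn ℝ (⊤ : ℕ∞) B (Icc 0 b))
    (hα : ContinuousOn α (Icc 0 b)) (hαg : ∀ x ∈ Ioo 0 b, x * g₁ x = α x)
    (hP' : ∀ x ∈ Ioo 0 b, HasDerivAt P (q x * P x) x)
    (hg' : ∀ x ∈ Ioo 0 b, HasDerivAt g (g₁ x) x)
    (hg₁ : ∀ x ∈ Ioo 0 b, HasDerivAt g₁ (-(c / x + q x) * g₁ x - B x / x * g x) x) :
    ContDiffOn ℝ (⊤ : ℕ∞) g (Icc 0 b) := by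
  set v : ℝ → ℂ := fun x => (P x)⁻¹ *
    ∫ t in (0 : ℝ)..1, ((t ^ (c - 1) : ℝ) : ℂ) * (-(P (t * x) * B (t * x) * g (t * x))) with hv
  have hw : Continuous fun t : ℝ => ((t ^ (c - 1) : ℝ) : ℂ) :=
    Complex.continuous_ofReal.comp (Real.continuous_rpow_const (by linarith))
  have hPBg : ContinuousOn (fun s => -(P s * B s * g s)) (Icc 0 b) :=
    ((hP.continuousOn.mul hB.continuousOn).mul hg).neg
  have key : ∀ x ∈ Ioo 0 b, g₁ x = v x := by
    intro x hx
    have hsub : Icc 0 x ⊆ Icc 0 b := Icc_subset_Icc le_rfl hx.2.le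
    have hxc : ((x ^ (c - 1) : ℝ) : ℂ) ≠ 0 := by
      exact_mod_cast (Real.rpow_pos_of_pos hx.1 _).ne'
    have hint : ContinuousOn
        (fun s => ((s ^ (c - 1) : ℝ) : ℂ) * -(P s * B s * g s)) (Icc 0 x) :=
      hw.continuousOn.mul (hPBg.mono hsub)
    have hcont : ContinuousOn (fun s => ((s ^ (c - 1) : ℝ) : ℂ) * (P s * α s)) (Icc 0 x) :=
      hw.continuousOn.mul ((hP.continuousOn.mul hα).mono hsub)
    have hderiv : ∀ s ∈ Ioo 0 x, HasDerivAt (fun s => ((s ^ (c - 1) : ℝ) : ℂ) * (P s * α s))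
        (((s ^ (c - 1) : ℝ) : ℂ) * -(P s * B s * g s)) s := by
      intro s hs
      have hsb : s ∈ Ioo 0 b := ⟨hs.1, hs.2.trans hx.2⟩
      have hs0 : (s : ℂ) ≠ 0 := by exact_mod_cast hs.1.ne'
      have h1 : HasDerivAt α (g₁ s + s * (-(c / s + q s) * g₁ s - B s / s * g s)) s := by
        have := ((hasDerivAt_id s).ofReal_comp).mul (hg₁ s hsb)
        simp only [Complex.ofReal_one, one_mul, id] at this
        refine this.congr_of_eventuallyEq ?_
        filter_upwards [Ioo_mem_nhds hsb.1 hsb.2] with y hy using (hαg y hy).symm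
      have h2 := (Real.hasDerivAt_rpow_const (p := c - 1) (Or.inl hs.1.ne')).ofReal_comp
      have h3 := h2.mul ((hP' s hsb).mul h1)
      refine h3.congr_deriv ?_
      rw [Pi.mul_apply, ← hαg s hsb, Real.rpow_sub_one hs.1.ne' (c - 1)]
      push_cast
      field_simp
      ring
    have h1 := intervalIntegral.integral_eq_sub_of_hasDerivAt_of_le hx.1.le hcont hderiv
      (ContinuousOn.intervalIntegrable (by rwa [uIcc_of_le hx.1.le]))
    rw [Real.zero_rpow (by linarith), ← hαg x hx, Complex.ofReal_zero] at h1
    have h2 := intervalIntegral.smul_integral_comp_mul_right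
      (fun s => ((s ^ (c - 1) : ℝ) : ℂ) * -(P s * B s * g s)) x (a := 0) (b := 1)
    have h3 : ∫ t in (0 : ℝ)..1,
          (((t * x) ^ (c - 1) : ℝ) : ℂ) * -(P (t * x) * B (t * x) * g (t * x)) =
        ((x ^ (c - 1) : ℝ) : ℂ) * ∫ t in (0 : ℝ)..1,
          ((t ^ (c - 1) : ℝ) : ℂ) * -(P (t * x) * B (t * x) * g (t * x)) := by
      rw [← intervalIntegral.integral_const_mul]
      refine intervalIntegral.integral_congr fun t ht => ?_
      rw [uIcc_of_le zero_le_one] at ht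
      simp only [Real.mul_rpow ht.1 hx.1.le, Complex.ofReal_mul]
      ring
    rw [zero_mul, one_mul, h1, h3, Complex.real_smul] at h2
    have hx0 : (x : ℂ) ≠ 0 := by exact_mod_cast hx.1.ne'
    rw [hv, eq_inv_mul_iff_mul_eq₀ (hP0 x (Ioo_subset_Icc_self hx))]
    refine mul_left_cancel₀ (mul_ne_zero hx0 hxc) ?_
    linear_combination -h2
  have hsucc : ∀ n : ℕ, ContDiffOn ℝ n g (Icc 0 b) := by
    intro n
    induction n with
    | zero => simpa using hg
    | succ n ih =>
      have hle : (n : WithTop ℕ∞) ≤ (⊤ : ℕ∞) := by exact_mod_cast le_top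
      refine contDiffOn_succ_Icc_of_hasDerivAt_Ioo hb hg (v := v) ?_
        fun x hx => key x hx ▸ hg' x hx
      exact ((hP.of_le hle).inv hP0).mul (contDiffOn_weightedAverage hb n hw.continuousOn
        (F := fun s => -(P s * B s * g s)) (((hP.of_le hle).mul (hB.of_le hle)).mul ih).neg)
  exact contDiffOn_infty.2 hsucc

theorem deriv_deriv_of_hasDerivAt_Ioo {f f₁ : ℝ → ℂ} {f₂ : ℂ} {a b x : ℝ} (hx : x ∈ Ioo a b)
    (h₁ : ∀ y ∈ Ioo a b, HasDerivAt f (f₁ y) y) (h₂ : HasDerivAt f₁ f₂ x) :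
    deriv (deriv f) x = f₂ := by
  have : deriv f =ᶠ[𝓝 x] f₁ := by
    filter_upwards [Ioo_mem_nhds hx.1 hx.2] with y hy using (h₁ y hy).deriv
  rw [this.deriv_eq, h₂.deriv]

theorem eqOn_zero_Icc_of_eqOn_zero_Ioo {u : ℝ → ℂ} (hu : ContinuousOn u (Icc 0 1))
    (h : ∀ x ∈ Ioo (0 : ℝ) 1, u x = 0) : ∀ x ∈ Icc (0 : ℝ) 1, u x = 0 := by
  have : EqOn u (fun _ => 0) (Icc 0 1) := by
    refine EqOn.of_subset_closure (s := Ioo 0 1) (fun x hx => h x hx) hu continuousOn_const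
      Ioo_subset_Icc_self ?_
    rw [closure_Ioo zero_ne_one]
  exact this

theorem one_add_sq_ne_zero (ρ : ℝ) : (1 + (ρ : ℂ) ^ 2) ≠ 0 := by
  have : (1 + ρ ^ 2 : ℝ) ≠ 0 := by positivity
  exact_mod_cast this

theorem one_sub_sq_ne_zero {ρ : ℝ} (hρ : ρ ∈ Ioo (0 : ℝ) 1) : (1 - (ρ : ℂ) ^ 2) ≠ 0 := by
  have : (1 - ρ ^ 2 : ℝ) ≠ 0 := by nlinarith [hρ.1, hρ.2]
  exact_mod_cast this

theorem contDiffOn_derivWithin_Icc {F : ℝ → ℂ} (hF : ContDiffOn ℝ (⊤ : ℕ∞) F (Icc 0 1)) :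
    ContDiffOn ℝ (⊤ : ℕ∞) (derivWithin F (Icc 0 1)) (Icc 0 1) :=
  hF.derivWithin (uniqueDiffOn_Icc zero_lt_one) (by norm_cast)

theorem SpectralEq.apply_zero {l : ℂ} {f : ℝ → ℂ} (hf : ContDiffOn ℝ (⊤ : ℕ∞) f (Icc 0 1))
    (heq : ∀ ρ ∈ Ioo (0 : ℝ) 1, SpectralEq l f ρ) : f 0 = 0 := by
  set f₁ := derivWithin f (Icc 0 1)
  set f₂ := derivWithin f₁ (Icc 0 1)
  have hf₁ : ContDiffOn ℝ (⊤ : ℕ∞) f₁ (Icc 0 1) := contDiffOn_derivWithin_Icc hf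
  have hf₂ : ContDiffOn ℝ (⊤ : ℕ∞) f₂ (Icc 0 1) := contDiffOn_derivWithin_Icc hf₁
  have hd : ∀ ρ ∈ Ioo (0 : ℝ) 1, HasDerivAt f (f₁ ρ) ρ := fun ρ hρ =>
    hasDerivAt_derivWithin_Icc (hf.differentiableOn (by simp)) hρ
  have hd₁ : ∀ ρ ∈ Ioo (0 : ℝ) 1, HasDerivAt f₁ (f₂ ρ) ρ := fun ρ hρ =>
    hasDerivAt_derivWithin_Icc (hf₁.differentiableOn (by simp)) hρ
  have h := eqOn_zero_Icc_of_eqOn_zero_Ioo (u := fun ρ : ℝ =>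
    (1 + (ρ : ℂ) ^ 2) ^ 2 * ((ρ : ℂ) ^ 2 * (-(1 - (ρ : ℂ) ^ 2) * f₂ ρ
      + 2 * (l + 1) * ρ * f₁ ρ + l * (l + 1) * f ρ) - 2 * ρ * f₁ ρ)
      + 2 * (1 - 6 * (ρ : ℂ) ^ 2 + (ρ : ℂ) ^ 4) * f ρ) ?_ ?_ 0 (by simp)
  · simpa using h
  · have h0 := hf.continuousOn
    have h1 := hf₁.continuousOn
    have h2 := hf₂.continuousOn
    fun_prop
  · intro ρ hρ
    have e := heq ρ hρ
    rw [SpectralEq, deriv_deriv_of_hasDerivAt_Ioo hρ hd (hd₁ ρ hρ), (hd ρ hρ).deriv] at e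
    have hρ0 : (ρ : ℂ) ≠ 0 := by exact_mod_cast hρ.1.ne'
    have h1 := one_add_sq_ne_zero ρ
    field_simp at e
    linear_combination e

/-- A smooth solution of the spectral equation is `ρ` times a smooth function `k` with
`k' = ρ m` for a smooth `m`. -/
theorem SpectralEq.exists_factorization {l : ℂ} {f : ℝ → ℂ}
    (hf : ContDiffOn ℝ (⊤ : ℕ∞) f (Icc 0 1))
    (heq : ∀ ρ ∈ Ioo (0 : ℝ) 1, SpectralEq l f ρ) :
    ∃ k m : ℝ → ℂ, ContDiffOn ℝ (⊤ : ℕ∞) k (Icc 0 1) ∧ ContDiffOn ℝ (⊤ : ℕ∞) m (Icc 0 1) ∧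
      (∀ ρ ∈ Icc (0 : ℝ) 1, f ρ = ρ * k ρ) ∧
      (∀ ρ ∈ Ioo (0 : ℝ) 1, HasDerivAt k (ρ * m ρ) ρ) ∧
      ∀ ρ ∈ Ioo (0 : ℝ) 1, HasDerivAt m
        ((((l + 1) * (l + 2) - 16 / (1 + (ρ : ℂ) ^ 2) ^ 2) * k ρ
          - (5 - (2 * l + 5) * (ρ : ℂ) ^ 2) * m ρ) / (ρ * (1 - (ρ : ℂ) ^ 2))) ρ := by
  obtain ⟨k, hk, hfk⟩ := exists_contDiffOn_eq_add_mul zero_lt_one hf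
  simp only [SpectralEq.apply_zero hf heq, zero_add] at hfk
  set k₁ := derivWithin k (Icc 0 1)
  set k₂ := derivWithin k₁ (Icc 0 1)
  have hk₁ : ContDiffOn ℝ (⊤ : ℕ∞) k₁ (Icc 0 1) := contDiffOn_derivWithin_Icc hk
  have hk₂ : ContDiffOn ℝ (⊤ : ℕ∞) k₂ (Icc 0 1) := contDiffOn_derivWithin_Icc hk₁
  have hd : ∀ ρ ∈ Ioo (0 : ℝ) 1, HasDerivAt k (k₁ ρ) ρ := fun ρ hρ =>
    hasDerivAt_derivWithin_Icc (hk.differentiableOn (by simp)) hρ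
  have hd₁ : ∀ ρ ∈ Ioo (0 : ℝ) 1, HasDerivAt k₁ (k₂ ρ) ρ := fun ρ hρ =>
    hasDerivAt_derivWithin_Icc (hk₁.differentiableOn (by simp)) hρ
  have hf₁ : ∀ ρ ∈ Ioo (0 : ℝ) 1, HasDerivAt f (k ρ + ρ * k₁ ρ) ρ := fun ρ hρ => by
    have := (hasDerivAt_id ρ).ofReal_comp.mul (hd ρ hρ)
    refine HasDerivAt.congr_of_eventuallyEq (by simpa using this) ?_
    filter_upwards [Ioo_mem_nhds hρ.1 hρ.2] with y hy using hfk y (Ioo_subset_Icc_self hy)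
  have hf₂ : ∀ ρ ∈ Ioo (0 : ℝ) 1, HasDerivAt (fun ρ => k ρ + ρ * k₁ ρ)
      (2 * k₁ ρ + ρ * k₂ ρ) ρ := fun ρ hρ => by
    have := (hd ρ hρ).add ((hasDerivAt_id ρ).ofReal_comp.mul (hd₁ ρ hρ))
    refine this.congr_deriv ?_
    simp only [Complex.ofReal_one, id]
    ring
  have ode : ∀ ρ ∈ Ioo (0 : ℝ) 1, (1 - (ρ : ℂ) ^ 2) * ρ * k₂ ρ
      + (4 - 2 * (l + 2) * (ρ : ℂ) ^ 2) * k₁ ρ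
      = ρ * ((l + 1) * (l + 2) - 16 / (1 + (ρ : ℂ) ^ 2) ^ 2) * k ρ := by
    intro ρ hρ
    have e := heq ρ hρ
    rw [SpectralEq, deriv_deriv_of_hasDerivAt_Ioo hρ hf₁ (hf₂ ρ hρ), (hf₁ ρ hρ).deriv,
      hfk ρ (Ioo_subset_Icc_self hρ)] at e
    have hρ0 : (ρ : ℂ) ≠ 0 := by exact_mod_cast hρ.1.ne'
    have h1 := one_add_sq_ne_zero ρ
    field_simp at e ⊢
    refine mul_left_cancel₀ hρ0 ?_
    linear_combination -e
  have hk₁0 : k₁ 0 = 0 := by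
    have h := eqOn_zero_Icc_of_eqOn_zero_Ioo (u := fun ρ : ℝ =>
      (1 - (ρ : ℂ) ^ 2) * ρ * k₂ ρ + (4 - 2 * (l + 2) * (ρ : ℂ) ^ 2) * k₁ ρ
      - ρ * ((l + 1) * (l + 2) - 16 / (1 + (ρ : ℂ) ^ 2) ^ 2) * k ρ) ?_
      (fun ρ hρ => sub_eq_zero.2 (ode ρ hρ)) 0 (by simp)
    · simpa using h
    · have h0 := hk.continuousOn
      have h1 := hk₁.continuousOn
      have h2 := hk₂.continuousOn
      have h3 : ContinuousOn (fun ρ : ℝ => 16 / (1 + (ρ : ℂ) ^ 2) ^ 2) (Icc 0 1) :=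
        ContinuousOn.div (by fun_prop) (by fun_prop)
          fun ρ _ => pow_ne_zero 2 (one_add_sq_ne_zero ρ)
      fun_prop
  obtain ⟨m, hm, hkm⟩ := exists_contDiffOn_eq_add_mul zero_lt_one hk₁
  simp only [hk₁0, zero_add] at hkm
  refine ⟨k, m, hk, hm, hfk, fun ρ hρ => hkm ρ (Ioo_subset_Icc_self hρ) ▸ hd ρ hρ,
    fun ρ hρ => ?_⟩
  have hdm := hasDerivAt_derivWithin_Icc (hm.differentiableOn (by simp)) hρ
  have hk₂m : k₂ ρ = m ρ + ρ * derivWithin m (Icc 0 1) ρ := by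
    refine (hd₁ ρ hρ).unique ?_
    have := (hasDerivAt_id ρ).ofReal_comp.mul hdm
    refine HasDerivAt.congr_of_eventuallyEq (by simpa using this) ?_
    filter_upwards [Ioo_mem_nhds hρ.1 hρ.2] with y hy using hkm y (Ioo_subset_Icc_self hy)
  refine hdm.congr_deriv ?_
  have e := ode ρ hρ
  rw [hk₂m, hkm ρ (Ioo_subset_Icc_self hρ)] at e
  have hρ0 : (ρ : ℂ) ≠ 0 := by exact_mod_cast hρ.1.ne'
  rw [eq_div_iff (mul_ne_zero hρ0 (one_sub_sq_ne_zero hρ))]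
  refine mul_left_cancel₀ hρ0 ?_
  linear_combination e

/-- The supersymmetric partner of a solution, divided by `ρ ^ 2`, in terms of the factorization
`f = ρ k`, `k' = ρ m`. -/
noncomputable def superPartner (l : ℂ) (k m : ℝ → ℂ) (ρ : ℝ) : ℂ :=
  (1 - (ρ : ℂ) ^ 2) * m ρ + ((1 - l) + 2 * (1 - (ρ : ℂ) ^ 2) / (1 + (ρ : ℂ) ^ 2)) * k ρ

theorem contDiff_ofReal_complex {n : WithTop ℕ∞} : ContDiff ℝ n (fun x : ℝ => (x : ℂ)) :=
  Complex.ofRealCLM.contDiff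

theorem contDiffOn_superPartner (l : ℂ) {k m : ℝ → ℂ} {s : Set ℝ}
    (hk : ContDiffOn ℝ (⊤ : ℕ∞) k s) (hm : ContDiffOn ℝ (⊤ : ℕ∞) m s) :
    ContDiffOn ℝ (⊤ : ℕ∞) (superPartner l k m) s := by
  have hsq : ContDiffOn ℝ (⊤ : ℕ∞) (fun x : ℝ => (x : ℂ) ^ 2) s :=
    (contDiff_ofReal_complex.pow 2).contDiffOn
  have hinv : ContDiffOn ℝ (⊤ : ℕ∞) (fun x : ℝ => (1 + (x : ℂ) ^ 2)⁻¹) s :=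
    (contDiffOn_const.add hsq).inv fun ρ _ => one_add_sq_ne_zero ρ
  exact ((contDiffOn_const.sub hsq).mul hm).add ((contDiffOn_const.add
    ((contDiffOn_const.mul (contDiffOn_const.sub hsq)).mul hinv)).mul hk)

theorem hasDerivAt_superPartner {l : ℂ} {k m : ℝ → ℂ} {ρ : ℝ} (hρ : ρ ∈ Ioo (0 : ℝ) 1)
    (hk : HasDerivAt k (ρ * m ρ) ρ)
    (hm : HasDerivAt m ((((l + 1) * (l + 2) - 16 / (1 + (ρ : ℂ) ^ 2) ^ 2) * k ρ
          - (5 - (2 * l + 5) * (ρ : ℂ) ^ 2) * m ρ) / (ρ * (1 - (ρ : ℂ) ^ 2))) ρ) :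
    HasDerivAt (superPartner l k m)
      ((-5 / ρ + 2 * ρ / (1 + (ρ : ℂ) ^ 2) + (l - 1) * ρ / (1 - (ρ : ℂ) ^ 2))
        * superPartner l k m ρ + (l - 1) ^ 2 / ((1 - (ρ : ℂ) ^ 2) * ρ) * k ρ) ρ := by
  have hρ0 : (ρ : ℂ) ≠ 0 := by exact_mod_cast hρ.1.ne'
  have h1 := one_add_sq_ne_zero ρ
  have h2 := one_sub_sq_ne_zero hρ
  have hsq := (hasDerivAt_id ρ).ofReal_comp.pow 2
  have := ((hsq.const_sub 1).mul hm).add ((((hsq.const_sub 1).const_mul 2).div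
    (hsq.const_add 1) h1).const_add (1 - l) |>.mul hk)
  refine this.congr_deriv ?_
  simp only [superPartner, id, Complex.ofReal_one, Pi.pow_apply, Pi.div_apply]
  field_simp
  ring

/-- The inverse of the change of variable `ρ ↦ 2 ρ ^ 2 / (1 + ρ ^ 2)`. -/
noncomputable def heunRadius (z : ℝ) : ℝ := √(z / (2 - z))

theorem heunRadius_mem_Icc {z : ℝ} (hz : z ∈ Icc (0 : ℝ) 1) : heunRadius z ∈ Icc (0 : ℝ) 1 := by
  refine ⟨Real.sqrt_nonneg _, Real.sqrt_le_one.2 ?_⟩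
  rw [div_le_one (by linarith [hz.2])]
  linarith [hz.2]

theorem heunRadius_mem_Ioo {z : ℝ} (hz : z ∈ Ioo (0 : ℝ) 1) : heunRadius z ∈ Ioo (0 : ℝ) 1 := by
  refine ⟨Real.sqrt_pos.2 (div_pos hz.1 (by linarith [hz.2])), ?_⟩
  rw [heunRadius, Real.sqrt_lt' one_pos, one_pow, div_lt_one (by linarith [hz.2])]
  linarith [hz.2]

theorem heunRadius_sq {z : ℝ} (hz : z ∈ Icc (0 : ℝ) 1) : heunRadius z ^ 2 = z / (2 - z) :=
  Real.sq_sqrt (div_nonneg hz.1 (by linarith [hz.2]))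

theorem heunRadius_two_mul_sq_div {ρ : ℝ} (hρ : 0 ≤ ρ) :
    heunRadius (2 * ρ ^ 2 / (1 + ρ ^ 2)) = ρ := by
  have : 2 * ρ ^ 2 / (1 + ρ ^ 2) / (2 - 2 * ρ ^ 2 / (1 + ρ ^ 2)) = ρ ^ 2 := by
    field_simp
    ring
  rw [heunRadius, this, Real.sqrt_sq hρ]

theorem hasDerivAt_heunRadius {z : ℝ} (hz : z ∈ Ioo (0 : ℝ) 1) :
    HasDerivAt heunRadius (1 / (heunRadius z * (2 - z) ^ 2)) z := by
  have h2 : 2 - z ≠ 0 := by linarith [hz.2]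
  have := ((hasDerivAt_id z).div ((hasDerivAt_id z).const_sub 2) h2).sqrt
    (div_pos hz.1 (by linarith [hz.2] : 0 < 2 - z)).ne'
  refine this.congr_deriv ?_
  have hr := (heunRadius_mem_Ioo hz).1.ne'
  change _ / (2 * heunRadius z) = _
  simp only [id]
  field_simp
  ring

theorem contDiffOn_heunRadius : ContDiffOn ℝ (⊤ : ℕ∞) heunRadius (Ioc 0 1) := by
  refine ContDiffOn.sqrt (contDiffOn_id.div (contDiffOn_const.sub contDiffOn_id) ?_) ?_
  · intro z hz
    exact (by linarith [hz.2] : 0 < 2 - z).ne'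
  · intro z hz
    exact (div_pos hz.1 (by linarith [hz.2] : 0 < 2 - z)).ne'

theorem continuousOn_heunRadius : ContinuousOn heunRadius (Icc 0 1) := by
  refine (continuousOn_id.div (continuousOn_const.sub continuousOn_id) ?_).sqrt
  intro z hz
  exact (by linarith [hz.2] : 0 < 2 - z).ne'

/-- The factor `(2 - z) ^ (-(1 + l / 2))`. -/
noncomputable def heunFactor (l : ℂ) (z : ℝ) : ℂ :=
  Complex.exp (-(1 + l / 2) * (Real.log (2 - z) : ℝ))

theorem contDiffOn_heunFactor (l : ℂ) : ContDiffOn ℝ (⊤ : ℕ∞) (heunFactor l) (Icc 0 1) := by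
  refine ContDiffOn.cexp (contDiffOn_const.mul (contDiff_ofReal_complex.comp_contDiffOn
    ((contDiffOn_const.sub contDiffOn_id).log ?_)))
  intro z hz
  simp only [id]
  linarith [hz.2]

theorem hasDerivAt_ofReal_log_sub {a z : ℝ} (hz : z < a) :
    HasDerivAt (fun z : ℝ => ((Real.log (a - z) : ℝ) : ℂ)) (1 / ((z : ℂ) - a)) z := by
  have := (((hasDerivAt_id z).const_sub a).log (by simp only [id]; linarith)).ofReal_comp
  refine this.congr_deriv ?_
  have : (z : ℂ) - a ≠ 0 := by exact_mod_cast (by linarith : z - a < 0).ne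
  have h' : (a : ℂ) - z ≠ 0 := by exact_mod_cast (by linarith : 0 < a - z).ne'
  simp only [id]
  push_cast
  field_simp
  ring

theorem hasDerivAt_heunFactor (l : ℂ) {z : ℝ} (hz : z < 2) :
    HasDerivAt (heunFactor l) ((1 + l / 2) / (2 - z) * heunFactor l z) z := by
  have := ((hasDerivAt_ofReal_log_sub hz).const_mul (-(1 + l / 2))).cexp
  refine this.congr_deriv ?_
  have h1 : (z : ℂ) - 2 ≠ 0 := by exact_mod_cast (by linarith : z - 2 < 0).ne
  have h2 : (2 : ℂ) - z ≠ 0 := by exact_mod_cast (by linarith : 0 < 2 - z).ne'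
  rw [heunFactor]
  push_cast
  field_simp
  ring

/-- The derivative of `g` in the first-order system for `(g, κ)` in the Heun variable. -/
noncomputable def heunDeriv (l : ℂ) (g κ : ℝ → ℂ) (z : ℝ) : ℂ :=
  ((1 + l / 2) + (-5 / z + 1 + (l - 1) / (2 * (1 - z)))) / (2 - z) * g z
    + (l - 1) ^ 2 / (2 * z * (1 - z)) * κ z

theorem Ioo_ne_zero {z : ℝ} (hz : z ∈ Ioo (0 : ℝ) 1) :
    (z : ℂ) ≠ 0 ∧ (1 - z : ℂ) ≠ 0 ∧ (z - 1 : ℂ) ≠ 0 ∧ (2 - z : ℂ) ≠ 0 ∧ (z - 2 : ℂ) ≠ 0 := by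
  obtain ⟨h0, h1⟩ := hz
  refine ⟨?_, ?_, ?_, ?_, ?_⟩
  · exact_mod_cast h0.ne'
  · exact_mod_cast (by linarith : 0 < 1 - z).ne'
  · exact_mod_cast (by linarith : z - 1 < 0).ne
  · exact_mod_cast (by linarith : 0 < 2 - z).ne'
  · exact_mod_cast (by linarith : z - 2 < 0).ne

theorem heunRadius_sq_complex {z : ℝ} (hz : z ∈ Icc (0 : ℝ) 1) :
    (heunRadius z : ℂ) ^ 2 = z / (2 - z) := by
  exact_mod_cast heunRadius_sq hz

theorem hasDerivAt_heunFactor_mul_superPartner {l : ℂ} {k m : ℝ → ℂ} {z : ℝ}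
    (hz : z ∈ Ioo (0 : ℝ) 1)
    (h : HasDerivAt (superPartner l k m)
      ((-5 / heunRadius z + 2 * heunRadius z / (1 + (heunRadius z : ℂ) ^ 2)
        + (l - 1) * heunRadius z / (1 - (heunRadius z : ℂ) ^ 2))
        * superPartner l k m (heunRadius z)
        + (l - 1) ^ 2 / ((1 - (heunRadius z : ℂ) ^ 2) * heunRadius z) * k (heunRadius z))
      (heunRadius z)) :
    HasDerivAt (fun z => heunFactor l z * superPartner l k m (heunRadius z))
      (heunDeriv l (fun z => heunFactor l z * superPartner l k m (heunRadius z))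
        (fun z => heunFactor l z * k (heunRadius z)) z) z := by
  have := (hasDerivAt_heunFactor l (by linarith [hz.2] : z < 2)).mul
    (h.scomp z (hasDerivAt_heunRadius hz))
  refine this.congr_deriv ?_
  obtain ⟨hz0, hz1, -, hz2, -⟩ := Ioo_ne_zero hz
  have hr0 : (heunRadius z : ℂ) ≠ 0 := by exact_mod_cast (heunRadius_mem_Ioo hz).1.ne'
  have hr1 := one_sub_sq_ne_zero (heunRadius_mem_Ioo hz)
  have hr2 := one_add_sq_ne_zero (heunRadius z)
  have hsq := heunRadius_sq_complex (Ioo_subset_Icc_self hz)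
  have e1 : (1 : ℂ) / (heunRadius z * (2 - z) ^ 2) * (-5 / heunRadius z
        + 2 * heunRadius z / (1 + (heunRadius z : ℂ) ^ 2)
        + (l - 1) * heunRadius z / (1 - (heunRadius z : ℂ) ^ 2)) =
      (-5 / z + 1 + (l - 1) / (2 * (1 - z))) / (2 - z) := by
    have : (1 : ℂ) / (heunRadius z * (2 - z) ^ 2) * (-5 / heunRadius z
        + 2 * heunRadius z / (1 + (heunRadius z : ℂ) ^ 2)
        + (l - 1) * heunRadius z / (1 - (heunRadius z : ℂ) ^ 2)) =
        1 / (2 - z) ^ 2 * (-5 / (heunRadius z : ℂ) ^ 2 + 2 / (1 + (heunRadius z : ℂ) ^ 2)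
        + (l - 1) / (1 - (heunRadius z : ℂ) ^ 2)) := by
      field_simp
    rw [this, hsq]
    have h1 : (1 : ℂ) + z / (2 - z) = 2 / (2 - z) := by field_simp; ring
    have h2 : (1 : ℂ) - z / (2 - z) = 2 * (1 - z) / (2 - z) := by field_simp; ring
    rw [h1, h2]
    field_simp
  have e2 : (1 : ℂ) / (heunRadius z * (2 - z) ^ 2) *
      ((l - 1) ^ 2 / ((1 - (heunRadius z : ℂ) ^ 2) * heunRadius z)) =
      (l - 1) ^ 2 / (2 * z * (1 - z)) := by
    have : (1 : ℂ) / (heunRadius z * (2 - z) ^ 2) *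
        ((l - 1) ^ 2 / ((1 - (heunRadius z : ℂ) ^ 2) * heunRadius z)) =
        (l - 1) ^ 2 / ((2 - z) ^ 2 * (1 - (heunRadius z : ℂ) ^ 2) * (heunRadius z : ℂ) ^ 2) := by
      field_simp
    have h2 : (1 : ℂ) - z / (2 - z) = 2 * (1 - z) / (2 - z) := by field_simp; ring
    rw [this, hsq, h2]
    field_simp
  simp only [heunDeriv, Complex.real_smul, Function.comp_apply]
  push_cast
  linear_combination (heunFactor l z * superPartner l k m (heunRadius z)) * e1 +
    (heunFactor l z * k (heunRadius z)) * e2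

theorem hasDerivAt_heunFactor_mul {l : ℂ} {k m : ℝ → ℂ} {z : ℝ}
    (hz : z ∈ Ioo (0 : ℝ) 1)
    (h : HasDerivAt k (heunRadius z * m (heunRadius z)) (heunRadius z)) :
    HasDerivAt (fun z => heunFactor l z * k (heunRadius z))
      ((1 + l / 2) / (2 - z) * (heunFactor l z * k (heunRadius z))
        + (heunFactor l z * superPartner l k m (heunRadius z)
          - ((1 - l) + 2 * (1 - z)) * (heunFactor l z * k (heunRadius z)))
          / (2 * (1 - z) * (2 - z))) z := by
  have := (hasDerivAt_heunFactor l (by linarith [hz.2] : z < 2)).mul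
    (h.scomp z (hasDerivAt_heunRadius hz))
  refine this.congr_deriv ?_
  obtain ⟨hz0, hz1, -, hz2, -⟩ := Ioo_ne_zero hz
  have hr0 : (heunRadius z : ℂ) ≠ 0 := by exact_mod_cast (heunRadius_mem_Ioo hz).1.ne'
  have hsq := heunRadius_sq_complex (Ioo_subset_Icc_self hz)
  have h1 : (1 : ℂ) + z / (2 - z) = 2 / (2 - z) := by field_simp; ring
  have h2 : (1 : ℂ) - z / (2 - z) = 2 * (1 - z) / (2 - z) := by field_simp; ring
  simp only [superPartner, Complex.real_smul, Function.comp_apply, hsq, h1, h2]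
  push_cast
  field_simp
  ring

/-- The first-order system implies the Heun equation. -/
theorem hasDerivAt_heunDeriv {l : ℂ} {g κ : ℝ → ℂ} {z : ℝ} (hz : z ∈ Ioo (0 : ℝ) 1)
    (hg : HasDerivAt g (heunDeriv l g κ z) z)
    (hκ : HasDerivAt κ ((1 + l / 2) / (2 - z) * κ z
        + (g z - ((1 - l) + 2 * (1 - z)) * κ z) / (2 * (1 - z) * (2 - z))) z) :
    HasDerivAt (heunDeriv l g κ)
      (-(((7 / 2 : ℝ) : ℂ) / z + (l / (z - 1) + 1 / (2 * (z - 2)))) * heunDeriv l g κ z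
        - (1 / 4 * ((l + 4) * (l + 2) * z - (l ^ 2 + 12 * l + 12)) / ((z - 1) * (z - 2))) / z
          * g z) z := by
  obtain ⟨hz0, hz1, hz1', hz2, hz2'⟩ := Ioo_ne_zero hz
  have hid : HasDerivAt (fun z : ℝ => (z : ℂ)) 1 z := by
    simpa using (hasDerivAt_id z).ofReal_comp
  have hA := ((((hid.fun_inv hz0).const_mul (-5)).add_const 1).add
    ((((hid.const_sub 1).const_mul 2).fun_inv (mul_ne_zero two_ne_zero hz1)).const_mul
      (l - 1))).const_add (1 + l / 2) |>.div (hid.const_sub 2) hz2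
  have hB := (((hid.const_mul 2).mul (hid.const_sub 1)).fun_inv
    (mul_ne_zero (mul_ne_zero two_ne_zero hz0) hz1)).const_mul ((l - 1) ^ 2)
  have := (hA.mul hg).add (hB.mul hκ)
  refine (this.congr_of_eventuallyEq (Eventually.of_forall fun y => ?_)).congr_deriv ?_
  · simp [heunDeriv, div_eq_mul_inv]
  · have e1 : (z - 1 : ℂ) = -(1 - z) := by ring
    have e2 : (z - 2 : ℂ) = -(2 - z) := by ring
    rw [e1, e2]
    simp only [heunDeriv, Pi.add_apply, Pi.mul_apply, Pi.div_apply]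
    push_cast
    field_simp
    ring

theorem contDiffOn_Icc_zero_half_of_heun {l : ℂ} {g κ : ℝ → ℂ}
    (hg : ContinuousOn g (Icc 0 1)) (hκ : ContinuousOn κ (Icc 0 1))
    (hg' : ∀ z ∈ Ioo (0 : ℝ) 1, HasDerivAt g (heunDeriv l g κ z) z)
    (hg₁ : ∀ z ∈ Ioo (0 : ℝ) 1, HasDerivAt (heunDeriv l g κ)
      (-(((7 / 2 : ℝ) : ℂ) / z + (l / (z - 1) + 1 / (2 * (z - 2)))) * heunDeriv l g κ z
        - (1 / 4 * ((l + 4) * (l + 2) * z - (l ^ 2 + 12 * l + 12)) / ((z - 1) * (z - 2))) / z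
          * g z) z) :
    ContDiffOn ℝ (⊤ : ℕ∞) g (Icc 0 (1 / 2)) := by
  have hsub : Icc (0 : ℝ) (1 / 2) ⊆ Icc 0 1 := Icc_subset_Icc le_rfl (by norm_num)
  have hsubo : Ioo (0 : ℝ) (1 / 2) ⊆ Ioo 0 1 := Ioo_subset_Ioo le_rfl (by norm_num)
  have hne : ∀ z ∈ Icc (0 : ℝ) (1 / 2),
      (1 - z : ℂ) ≠ 0 ∧ (z - 1 : ℂ) ≠ 0 ∧ (2 - z : ℂ) ≠ 0 ∧ (z - 2 : ℂ) ≠ 0 := by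
    intro z hz
    refine ⟨?_, ?_, ?_, ?_⟩
    · exact_mod_cast (by linarith [hz.2] : 0 < 1 - z).ne'
    · exact_mod_cast (by linarith [hz.2] : z - 1 < 0).ne
    · exact_mod_cast (by linarith [hz.2] : 0 < 2 - z).ne'
    · exact_mod_cast (by linarith [hz.2] : z - 2 < 0).ne
  have hlog : ∀ a : ℝ, 1 ≤ a →
      ContDiffOn ℝ (⊤ : ℕ∞) (fun z : ℝ => ((Real.log (a - z) : ℝ) : ℂ)) (Icc 0 (1 / 2)) := by
    intro a ha
    refine contDiff_ofReal_complex.comp_contDiffOn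
      ((contDiffOn_const.sub contDiffOn_id).log fun z hz => ?_)
    exact (by linarith [hz.2] : 0 < a - z).ne'
  refine contDiffOn_of_regularSingular (c := 7 / 2) (g₁ := heunDeriv l g κ)
    (P := fun z => Complex.exp (l * (Real.log (1 - z) : ℝ) + 1 / 2 * (Real.log (2 - z) : ℝ)))
    (q := fun z => l / (z - 1) + 1 / (2 * (z - 2)))
    (B := fun z =>
      1 / 4 * ((l + 4) * (l + 2) * z - (l ^ 2 + 12 * l + 12)) / ((z - 1) * (z - 2)))
    (α := fun z => ((1 + l / 2) * z + (-5 + z + z * (l - 1) / (2 * (1 - z)))) / (2 - z) * g z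
      + (l - 1) ^ 2 / (2 * (1 - z)) * κ z)
    (by norm_num) (by norm_num) (hg.mono hsub) ?_ (fun _ _ => Complex.exp_ne_zero _) ?_ ?_ ?_ ?_
    (fun z hz => hg' z (hsubo hz)) (fun z hz => hg₁ z (hsubo hz))
  · exact ((contDiffOn_const.mul (hlog 1 le_rfl)).add
      (contDiffOn_const.mul (hlog 2 one_le_two))).cexp
  · have hid : ContDiffOn ℝ (⊤ : ℕ∞) (fun z : ℝ => (z : ℂ)) (Icc 0 (1 / 2)) :=
      contDiff_ofReal_complex.contDiffOn
    exact (contDiffOn_const.mul ((contDiffOn_const.mul hid).sub contDiffOn_const)).mul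
      (((hid.sub contDiffOn_const).mul (hid.sub contDiffOn_const)).inv
        fun z hz => mul_ne_zero (hne z hz).2.1 (hne z hz).2.2.2)
  · have h1 : ContinuousOn (fun z : ℝ => (z : ℂ) * (l - 1) / (2 * (1 - z))) (Icc 0 (1 / 2)) :=
      ContinuousOn.div (by fun_prop) (by fun_prop)
        fun z hz => mul_ne_zero two_ne_zero (hne z hz).1
    have h2 : ContinuousOn (fun z : ℝ => (l - 1) ^ 2 / (2 * (1 - (z : ℂ)))) (Icc 0 (1 / 2)) :=
      ContinuousOn.div (by fun_prop) (by fun_prop)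
        fun z hz => mul_ne_zero two_ne_zero (hne z hz).1
    have h3 : ContinuousOn (fun z : ℝ => ((1 + l / 2) * z +
        (-5 + z + z * (l - 1) / (2 * (1 - z)))) / (2 - (z : ℂ))) (Icc 0 (1 / 2)) :=
      ContinuousOn.div (by fun_prop) (by fun_prop) fun z hz => (hne z hz).2.2.1
    exact (h3.mul (hg.mono hsub)).add (h2.mul (hκ.mono hsub))
  · intro z hz
    obtain ⟨hz0, hz1, -, hz2, -⟩ := Ioo_ne_zero (hsubo hz)
    simp only [heunDeriv]
    field_simp
  · intro z hz
    have := (((hasDerivAt_ofReal_log_sub (a := 1) (by linarith [hz.2])).const_mul l).add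
      ((hasDerivAt_ofReal_log_sub (a := 2) (by linarith [hz.2])).const_mul (1 / 2))).cexp
    refine this.congr_deriv ?_
    obtain ⟨-, -, hz1, -, hz2⟩ := Ioo_ne_zero (hsubo hz)
    simp only [Pi.add_apply]
    push_cast
    field_simp

/-- Reduction of the spectral problem to a Heun equation in standard form. -/
theorem reduction_to_heun (l : ℂ) (hl : l ≠ 1) (f : ℝ → ℂ)
    (hf : ContDiffOn ℝ (⊤ : ℕ∞) f (Icc 0 1))
    (hf0 : ∃ ρ ∈ Icc (0 : ℝ) 1, f ρ ≠ 0)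
    (heq : ∀ ρ ∈ Ioo (0 : ℝ) 1, SpectralEq l f ρ) :
    ∃ g : ℝ → ℂ, ContDiffOn ℝ (⊤ : ℕ∞) g (Icc 0 1) ∧ (∃ z ∈ Icc (0 : ℝ) 1, g z ≠ 0) ∧
      ∀ z ∈ Ioo (0 : ℝ) 1, HeunEq l g z := by
  obtain ⟨k, m, hk, hm, hfk, hdk, hdm⟩ := SpectralEq.exists_factorization hf heq
  have hh := contDiffOn_superPartner l hk hm
  have hE := contDiffOn_heunFactor l
  set g : ℝ → ℂ := fun z => heunFactor l z * superPartner l k m (heunRadius z) with hgdef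
  set κ : ℝ → ℂ := fun z => heunFactor l z * k (heunRadius z) with hκdef
  have hmaps : MapsTo heunRadius (Icc 0 1) (Icc 0 1) := fun z hz => heunRadius_mem_Icc hz
  have hgc : ContinuousOn g (Icc 0 1) :=
    hE.continuousOn.mul (hh.continuousOn.comp continuousOn_heunRadius hmaps)
  have hκc : ContinuousOn κ (Icc 0 1) :=
    hE.continuousOn.mul (hk.continuousOn.comp continuousOn_heunRadius hmaps)
  have hg' : ∀ z ∈ Ioo (0 : ℝ) 1, HasDerivAt g (heunDeriv l g κ z) z := fun z hz =>
    have hr := heunRadius_mem_Ioo hz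
    hasDerivAt_heunFactor_mul_superPartner hz (hasDerivAt_superPartner hr (hdk _ hr) (hdm _ hr))
  have hg₁ := fun z hz => hasDerivAt_heunDeriv hz (hg' z hz)
    (hasDerivAt_heunFactor_mul (l := l) hz (hdk _ (heunRadius_mem_Ioo hz)))
  refine ⟨g, ?_, ?_, ?_⟩
  · have hleft := contDiffOn_Icc_zero_half_of_heun hgc hκc hg' hg₁
    have hright : ContDiffOn ℝ (⊤ : ℕ∞) g (Ioc 0 1) :=
      (hE.mono Ioc_subset_Icc_self).mul
        (hh.comp contDiffOn_heunRadius (hmaps.mono_left Ioc_subset_Icc_self))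
    intro z hz
    rcases eq_or_lt_of_le hz.1 with rfl | hz0
    · refine (hleft 0 (by norm_num)).mono_of_mem_nhdsWithin ?_
      filter_upwards [self_mem_nhdsWithin,
        mem_nhdsWithin_of_mem_nhds (Iio_mem_nhds (by norm_num : (0 : ℝ) < 1 / 2))] with y hy hy'
      exact ⟨hy.1, le_of_lt hy'⟩
    · refine (hright z ⟨hz0, hz.2⟩).mono_of_mem_nhdsWithin ?_
      filter_upwards [self_mem_nhdsWithin, mem_nhdsWithin_of_mem_nhds (Ioi_mem_nhds hz0)]
        with y hy hy'
      exact ⟨hy', hy.2⟩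
  · by_contra! hg0
    obtain ⟨ρ₀, hρ₀, hfρ₀⟩ := hf0
    refine hfρ₀ (eqOn_zero_Icc_of_eqOn_zero_Ioo hf.continuousOn (fun ρ hρ => ?_) ρ₀ hρ₀)
    set z := 2 * ρ ^ 2 / (1 + ρ ^ 2) with hzdef
    have hz : z ∈ Ioo (0 : ℝ) 1 := by
      have := hρ.1
      refine ⟨by positivity, ?_⟩
      rw [hzdef, div_lt_one (by positivity)]
      nlinarith [hρ.2]
    have hzero : HasDerivAt g 0 z := by
      refine (hasDerivAt_const z (0 : ℂ)).congr_of_eventuallyEq ?_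
      filter_upwards [Ioo_mem_nhds hz.1 hz.2] with y hy using hg0 y (Ioo_subset_Icc_self hy)
    have e := (hg' z hz).unique hzero
    obtain ⟨hz0, hz1, -, -, -⟩ := Ioo_ne_zero hz
    have hcoef : (l - 1) ^ 2 / (2 * z * (1 - z)) ≠ 0 :=
      div_ne_zero (pow_ne_zero 2 (sub_ne_zero.2 hl))
        (mul_ne_zero (mul_ne_zero two_ne_zero hz0) hz1)
    rw [heunDeriv, hg0 z (Ioo_subset_Icc_self hz), mul_zero, zero_add] at e
    have hkρ := ((mul_eq_zero.1 ((mul_eq_zero.1 e).resolve_left hcoef)).resolve_left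
      (Complex.exp_ne_zero _))
    rw [heunRadius_two_mul_sq_div hρ.1.le] at hkρ
    rw [hfk ρ (Ioo_subset_Icc_self hρ), hkρ, mul_zero]
  · intro z hz
    rw [HeunEq, deriv_deriv_of_hasDerivAt_Ioo hz hg' (hg₁ z hz), (hg' z hz).deriv]
    obtain ⟨hz0, -, hz1, -, hz2⟩ := Ioo_ne_zero hz
    push_cast
    field_simp
    ring
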